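/- Let F be a full superfield. Then F[X] is a principal ideal superdomain: every ideal I of F[X] is of the form I = ⟨p⟩ for some p ∈ F[X]; moreover I = F[X]·p, i.e. I = ∪_{h ∈ F[X]} h·p. -/

import Mathlib

universe u v

/-- A structure carrying two multivalued (set-valued) binary operations, a negation,
a zero and a one, on a type `A`. -/
structure SuperringStruct (A : Type u) where
  add : A → A → Set A
  mul : A → A → Set A
  neg : A → A
  zero : A
  one : A

namespace SuperringStruct

variable {A : Type u}

/-- Elementwise (multivalued) sum of two subsets: `X + Y = ⋃ {x + y : x ∈ X, y ∈ Y}`. -/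
def sadd (R : SuperringStruct A) (X Y : Set A) : Set A := ⋃ x ∈ X, ⋃ y ∈ Y, R.add x y

/-- Elementwise (multivalued) product of two subsets. -/
def smul (R : SuperringStruct A) (X Y : Set A) : Set A := ⋃ x ∈ X, ⋃ y ∈ Y, R.mul x y

end SuperringStruct

/-- The axioms of a superring. -/
structure IsSuperring {A : Type u} (R : SuperringStruct A) : Prop where
  add_nonempty : ∀ a b : A, (R.add a b).Nonempty
  mul_nonempty : ∀ a b : A, (R.mul a b).Nonempty
  add_comm : ∀ a b : A, R.add a b = R.add b a
  add_M1 : ∀ a b c : A, c ∈ R.add a b → a ∈ R.add c (R.neg b) ∧ b ∈ R.add (R.neg a) c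
  add_M2 : ∀ a b : A, b ∈ R.add a R.zero ↔ a = b
  add_M3 : ∀ a b c x t : A, x ∈ R.add a b → t ∈ R.add x c →
    ∃ y ∈ R.add b c, t ∈ R.add a y
  mul_comm : ∀ a b : A, R.mul a b = R.mul b a
  mul_M3 : ∀ a b c x t : A, x ∈ R.mul a b → t ∈ R.mul x c →
    ∃ y ∈ R.mul b c, t ∈ R.mul a y
  one_mul_mem : ∀ a : A, a ∈ R.mul R.one a
  mul_zero : ∀ a : A, R.mul a R.zero = {R.zero}
  distrib : ∀ a b c x d : A, x ∈ R.add a b → d ∈ R.mul c x →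
    d ∈ R.sadd (R.mul c a) (R.mul c b)
  neg_mul : ∀ a b : A, R.neg '' R.mul a b = R.mul (R.neg a) b
  mul_neg : ∀ a b : A, R.neg '' R.mul a b = R.mul a (R.neg b)

theorem IsSuperring.neg_zero {A : Type u} {R : SuperringStruct A} (h : IsSuperring R) :
    R.neg R.zero = R.zero := by
  have h0 : R.zero ∈ R.add R.zero R.zero := (h.add_M2 R.zero R.zero).mpr rfl
  exact (h.add_M2 _ _).mp (h.add_M1 _ _ _ h0).2

/-- A superring is *full* if `d ∈ c·(a+b)` iff `d ∈ c·a + c·b`. -/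
def SuperringStruct.IsFull {A : Type u} (R : SuperringStruct A) : Prop :=
  ∀ a b c d : A, (∃ x ∈ R.add a b, d ∈ R.mul c x) ↔ d ∈ R.sadd (R.mul c a) (R.mul c b)

/-- A superdomain: a superring with `0 ≠ 1` and no zero divisors. -/
def IsSuperdomain {A : Type u} (R : SuperringStruct A) : Prop :=
  IsSuperring R ∧ R.zero ≠ R.one ∧
    ∀ a b : A, R.zero ∈ R.mul a b → a = R.zero ∨ b = R.zero

/-- A superfield: a superdomain in which every nonzero element is invertible. -/
def IsSuperfield {A : Type u} (R : SuperringStruct A) : Prop :=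
  IsSuperdomain R ∧ ∀ a : A, a ≠ R.zero → ∃ b : A, R.one ∈ R.mul a b

/-- A hyperfield: a superring with single-valued product, `0 ≠ 1`,
and multiplicative inverses for nonzero elements. -/
def IsHyperfield {A : Type u} (R : SuperringStruct A) : Prop :=
  IsSuperring R ∧ (∀ a b : A, ∃ c : A, R.mul a b = {c}) ∧ R.zero ≠ R.one ∧
    ∀ a : A, a ≠ R.zero → ∃ b : A, R.one ∈ R.mul a b

/-- An ideal of a superring: a nonempty subset `I` with `I + I ⊆ I` and `A·I ⊆ I`. -/
def IsIdeal {A : Type u} (R : SuperringStruct A) (I : Set A) : Prop :=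
  I.Nonempty ∧ R.sadd I I ⊆ I ∧ R.smul Set.univ I ⊆ I

/-- A prime ideal: `1 ∉ p` and `a·b ⊆ p` implies `a ∈ p` or `b ∈ p`. -/
def IsPrimeIdeal {A : Type u} (R : SuperringStruct A) (I : Set A) : Prop :=
  R.one ∉ I ∧ ∀ a b : A, R.mul a b ⊆ I → a ∈ I ∨ b ∈ I

/-- A strongly prime ideal: `1 ∉ p` and `(a·b) ∩ p ≠ ∅` implies `a ∈ p` or `b ∈ p`. -/
def IsStronglyPrimeIdeal {A : Type u} (R : SuperringStruct A) (I : Set A) : Prop :=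
  R.one ∉ I ∧ ∀ a b : A, (R.mul a b ∩ I).Nonempty → a ∈ I ∨ b ∈ I

/-- A maximal ideal: `1 ∉ m` and the only ideals containing `m` are `m` and the whole ring. -/
def IsMaximalIdeal {A : Type u} (R : SuperringStruct A) (I : Set A) : Prop :=
  R.one ∉ I ∧ ∀ J : Set A, IsIdeal R J → I ⊆ J → J = I ∨ J = Set.univ

/-- The ideal generated by an element: the intersection of all ideals containing it. -/
def genIdeal {A : Type u} (R : SuperringStruct A) (a : A) : Set A :=
  ⋂₀ {I : Set A | IsIdeal R I ∧ a ∈ I}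

/-- Two elements are identified in the quotient `A/I` iff they have the same coset `x + I`. -/
def cosetRel {A : Type u} (R : SuperringStruct A) (I : Set A) (x y : A) : Prop :=
  R.sadd {x} I = R.sadd {y} I

/-- The quotient superring structure `A/I`, with classes `x̄ = x + I` and
multioperations `x̄ + ȳ = {z̄ : z ∈ x + y}`, `x̄·ȳ = {z̄ : z ∈ x·y}`, `-x̄ = (-x)‾`. -/
noncomputable def quotStruct {A : Type u} (R : SuperringStruct A) (I : Set A) :
    SuperringStruct (Quot (cosetRel R I)) where
  add X Y := {Z | ∃ x y z : A,
    Quot.mk _ x = X ∧ Quot.mk _ y = Y ∧ Quot.mk _ z = Z ∧ z ∈ R.add x y}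
  mul X Y := {Z | ∃ x y z : A,
    Quot.mk _ x = X ∧ Quot.mk _ y = Y ∧ Quot.mk _ z = Z ∧ z ∈ R.mul x y}
  neg X := Quot.mk _ (R.neg X.out)
  zero := Quot.mk _ R.zero
  one := Quot.mk _ R.one

/-- A morphism of superrings. -/
def IsMorphism {A : Type u} {B : Type v} (R : SuperringStruct A) (S : SuperringStruct B)
    (f : A → B) : Prop :=
  f R.zero = S.zero ∧ f R.one = S.one ∧ (∀ a : A, f (R.neg a) = S.neg (f a)) ∧
    (∀ a b c : A, c ∈ R.add a b → f c ∈ S.add (f a) (f b)) ∧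
    (∀ a b c : A, c ∈ R.mul a b → f c ∈ S.mul (f a) (f b))

/-- Marshall's relation: `a ∼_S b` iff `a·X = b·Y` for some nonempty `X, Y ⊆ S`. -/
def msRel {A : Type u} (R : SuperringStruct A) (S : Set A) (a b : A) : Prop :=
  ∃ X Y : Set A, X ⊆ S ∧ X.Nonempty ∧ Y ⊆ S ∧ Y.Nonempty ∧ R.smul {a} X = R.smul {b} Y

/-- A Marshall coherent subset: multiplicative, and whenever `x ∈ a·s` with `s ∈ S`,
there are nonempty `P, Q ⊆ S` with `x·P = a·Q`. -/
def MarshallCoherent {A : Type u} (R : SuperringStruct A) (S : Set A) : Prop :=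
  R.one ∈ S ∧ (∀ s ∈ S, ∀ v ∈ S, R.mul s v ⊆ S) ∧
    ∀ a x : A, ∀ s ∈ S, x ∈ R.mul a s →
      ∃ P Q : Set A, P ⊆ S ∧ P.Nonempty ∧ Q ⊆ S ∧ Q.Nonempty ∧
        R.smul {x} P = R.smul {a} Q

/-- The Marshall quotient superring structure `A/_m S` on the classes of `∼_S`. -/
noncomputable def marshallStruct {A : Type u} (R : SuperringStruct A) (S : Set A) :
    SuperringStruct (Quot (msRel R S)) where
  add X Y := {Z | ∃ a b c : A,
    Quot.mk _ a = X ∧ Quot.mk _ b = Y ∧ Quot.mk _ c = Z ∧ c ∈ R.add a b}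
  mul X Y := {Z | ∃ a b c : A,
    Quot.mk _ a = X ∧ Quot.mk _ b = Y ∧ Quot.mk _ c = Z ∧ c ∈ R.mul a b}
  neg X := Quot.mk _ (R.neg X.out)
  zero := Quot.mk _ R.zero
  one := Quot.mk _ R.one

/-- Finite multivalued sums: `x ∈ Σ_{i<0} g i` iff `x = 0`;
`Σ_{i<p+1} g i = (Σ_{i<p} g i) + g p` elementwise. -/
def setSumUpTo {A : Type u} (R : SuperringStruct A) (g : ℕ → Set A) : ℕ → Set A
  | 0 => {R.zero}
  | n + 1 => R.sadd (setSumUpTo R g n) (g n)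

/-- Multivalued powers: `α^0 = {1}`, `α^{n+1} = α^n · α` elementwise. -/
def setPow {A : Type u} (R : SuperringStruct A) (α : A) : ℕ → Set A
  | 0 => {R.one}
  | n + 1 => R.smul (setPow R α n) {α}

/-- The evaluation set `c 0 + c 1 · α + ⋯ + c m · α^m` (a finite multivalued sum of
multivalued products). -/
def evalSet {A : Type u} (R : SuperringStruct A) (c : ℕ → A) (m : ℕ) (α : A) : Set A :=
  setSumUpTo R (fun j => R.smul {c j} (setPow R α j)) (m + 1)

/-- The iterated multivalued product of a list: `Π_{i<0} = {1}` and
`t ∈ f₁·…·fₙ` iff `t ∈ y·fₙ` for some `y ∈ f₁·…·f_{n-1}`. -/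
def listProd {A : Type u} (R : SuperringStruct A) (l : List A) : Set A :=
  l.foldl (fun X a => R.smul X {a}) {R.one}

/-- The carrier of `R[X]`: eventually-zero sequences in `R`. -/
def PolyCarrier {A : Type u} (R : SuperringStruct A) : Type u :=
  {f : ℕ → A // ∃ N : ℕ, ∀ n : ℕ, N ≤ n → f n = R.zero}

/-- The superring of polynomials `R[X]` with the convolution multioperations. -/
def polyStruct {A : Type u} (R : SuperringStruct A) (h : IsSuperring R) :
    SuperringStruct (PolyCarrier R) where
  add f g := {c | ∀ n : ℕ, c.1 n ∈ R.add (f.1 n) (g.1 n)}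
  mul f g := {c | ∀ n : ℕ,
    c.1 n ∈ setSumUpTo R (fun j => R.mul (f.1 j) (g.1 (n - j))) (n + 1)}
  neg f := ⟨fun n => R.neg (f.1 n), by
    obtain ⟨N, hN⟩ := f.2
    exact ⟨N, fun n hn => by
      show R.neg (f.1 n) = R.zero
      rw [hN n hn, h.neg_zero]⟩⟩
  zero := ⟨fun _ => R.zero, ⟨0, fun _ _ => rfl⟩⟩
  one := ⟨fun n => if n = 0 then R.one else R.zero, ⟨1, fun n hn => if_neg (by omega)⟩⟩

/-- The degree of a polynomial: the largest `n` with nonzero `n`-th coefficient. -/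
noncomputable def polyDeg {A : Type u} (R : SuperringStruct A) (f : PolyCarrier R) : ℕ :=
  sSup {n : ℕ | f.1 n ≠ R.zero}

/-- The constant polynomial. -/
def constPoly {A : Type u} (R : SuperringStruct A) (a : A) : PolyCarrier R :=
  ⟨fun n => if n = 0 then a else R.zero, ⟨1, fun n hn => if_neg (by omega)⟩⟩

/-- The monomial `d·X^r`. -/
def monoPoly {A : Type u} (R : SuperringStruct A) (d : A) (r : ℕ) : PolyCarrier R :=
  ⟨fun n => if n = r then d else R.zero, ⟨r + 1, fun n hn => if_neg (by omega)⟩⟩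

/-- The polynomial `X`. -/
def XPoly {A : Type u} (R : SuperringStruct A) : PolyCarrier R :=
  ⟨fun n => if n = 1 then R.one else R.zero, ⟨2, fun n hn => if_neg (by omega)⟩⟩

/-- The polynomial `X - a = (-a, 1, 0, …)`. -/
def XsubC {A : Type u} (R : SuperringStruct A) (a : A) : PolyCarrier R :=
  ⟨fun n => if n = 0 then R.neg a else if n = 1 then R.one else R.zero,
   ⟨2, fun n hn => by
     show (if n = 0 then R.neg a else if n = 1 then R.one else R.zero) = R.zero
     rw [if_neg (by omega), if_neg (by omega)]⟩⟩

/-- The polynomial obtained from `g` by putting `d` in the `r`-th coefficient. -/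
def putCoeff {A : Type u} (R : SuperringStruct A) (g : PolyCarrier R) (d : A) (r : ℕ) :
    PolyCarrier R :=
  ⟨fun n => if n = r then d else g.1 n, by
    obtain ⟨N, hN⟩ := g.2
    exact ⟨max N (r + 1), fun n hn => by
      show (if n = r then d else g.1 n) = R.zero
      rw [if_neg (by omega), hN n (by omega)]⟩⟩

/-- A polynomial `f` is irreducible if `deg f ≥ 1` and `f ∈ ⟨u⟩` implies `⟨f⟩ = ⟨u⟩`. -/
noncomputable def IsIrreduciblePoly {A : Type u} (R : SuperringStruct A) (h : IsSuperring R)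
    (f : PolyCarrier R) : Prop :=
  1 ≤ polyDeg R f ∧ ∀ u : PolyCarrier R, f ∈ genIdeal (polyStruct R h) u →
    genIdeal (polyStruct R h) f = genIdeal (polyStruct R h) u

theorem aux_mem_sadd {A : Type u} {R : SuperringStruct A} {X Y : Set A} {t : A} :
    t ∈ R.sadd X Y ↔ ∃ x ∈ X, ∃ y ∈ Y, t ∈ R.add x y := by
  simp [SuperringStruct.sadd]

theorem aux_mem_smul {A : Type u} {R : SuperringStruct A} {X Y : Set A} {t : A} :
    t ∈ R.smul X Y ↔ ∃ x ∈ X, ∃ y ∈ Y, t ∈ R.mul x y := by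
  simp [SuperringStruct.smul]

theorem aux_sum_congr {A : Type u} {R : SuperringStruct A} {G H : ℕ → Set A} (n : ℕ)
    (hGH : ∀ j < n, H j = G j) : setSumUpTo R H n = setSumUpTo R G n := by
  induction n with
  | zero => rfl
  | succ n ih =>
    simp only [setSumUpTo]
    rw [ih (fun j hj => hGH j (by omega)), hGH n (by omega)]

/-- Replacing a zero summand of a multivalued sum by another set. -/
theorem aux_sum_insert {A : Type u} {R : SuperringStruct A} (h : IsSuperring R)
    {G H : ℕ → Set A} {i : ℕ} {x : A} (hx : x ∈ H i) (hG : G i = {R.zero})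
    (n : ℕ) (hi : i < n) (hGH : ∀ j < n, j ≠ i → H j = G j) (s t : A)
    (hs : s ∈ setSumUpTo R G n) (ht : t ∈ R.add s x) : t ∈ setSumUpTo R H n := by
  induction n generalizing s t with
  | zero => omega
  | succ n ih =>
    simp only [setSumUpTo] at hs ⊢
    rw [aux_mem_sadd] at hs ⊢
    obtain ⟨s', hs', y, hy, hsy⟩ := hs
    by_cases hin : i = n
    · subst hin
      rw [hG] at hy
      have hy0 : y = R.zero := hy
      subst hy0
      have := (h.add_M2 _ _).mp hsy
      subst this
      refine ⟨s', ?_, x, hx, ht⟩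
      rw [aux_sum_congr i (fun j hj => hGH j (by omega) (by omega))]
      exact hs'
    · rw [h.add_comm] at hsy
      obtain ⟨z, hz, htz⟩ := h.add_M3 _ _ _ _ _ hsy ht
      refine ⟨z, ih (by omega) (fun j hj => hGH j (by omega)) _ _ hs' hz, y, ?_, ?_⟩
      · rw [hGH n (by omega) (fun e => hin e.symm)]; exact hy
      · rw [h.add_comm]; exact htz

theorem aux_sum_zero {A : Type u} {R : SuperringStruct A} (h : IsSuperring R)
    {G : ℕ → Set A} (n : ℕ) (hG : ∀ j < n, G j = {R.zero}) :
    setSumUpTo R G n = {R.zero} := by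
  induction n with
  | zero => rfl
  | succ n ih =>
    ext t
    simp only [setSumUpTo]
    rw [ih (fun j hj => hG j (by omega)), hG n (by omega), aux_mem_sadd]
    simp [h.add_M2, eq_comm]

theorem aux_zero_mul {A : Type u} {R : SuperringStruct A} (h : IsSuperring R) (a : A) :
    R.mul R.zero a = {R.zero} := by
  rw [h.mul_comm, h.mul_zero]

/-- Multiplication by a monomial. -/
theorem aux_mono_mul {A : Type u} {R : SuperringStruct A} (h : IsSuperring R)
    (d : A) (r : ℕ) (g x : PolyCarrier R) (hlt : ∀ k < r, x.1 k = R.zero)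
    (hge : ∀ k, r ≤ k → x.1 k ∈ R.mul d (g.1 (k - r))) :
    x ∈ (polyStruct R h).mul (monoPoly R d r) g := by
  intro k
  by_cases hk : k < r
  · rw [aux_sum_zero h, hlt k hk]
    · rfl
    · intro j hj
      have : (monoPoly R d r).1 j = R.zero := if_neg (by omega)
      rw [this, aux_zero_mul h]
  · refine aux_sum_insert h (G := fun _ => {R.zero}) (i := r) (x := x.1 k) (s := R.zero)
      ?_ rfl _ (by omega) ?_ _ ?_ ?_
    · have : (monoPoly R d r).1 r = d := if_pos rfl
      rw [this]
      exact hge k (by omega)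
    · intro j _ hj
      have : (monoPoly R d r).1 j = R.zero := if_neg hj
      simp only [this, aux_zero_mul h]
    · rw [aux_sum_zero h _ (fun _ _ => rfl)]; rfl
    · rw [h.add_comm]; exact (h.add_M2 _ _).mpr rfl

theorem aux_neg_mem {A : Type u} {R : SuperringStruct A} (h : IsSuperring R)
    {I : Set (PolyCarrier R)} (hI : IsIdeal (polyStruct R h) I) {x : PolyCarrier R}
    (hx : x ∈ I) : (polyStruct R h).neg x ∈ I := by
  refine hI.2.2 (aux_mem_smul.mpr ⟨monoPoly R (R.neg R.one) 0, trivial, x, hx, ?_⟩)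
  refine aux_mono_mul h _ _ _ _ (fun k hk => by omega) (fun k _ => ?_)
  rw [← h.neg_mul]
  exact ⟨x.1 k, h.one_mul_mem _, rfl⟩

theorem aux_div {A : Type u} {R : SuperringStruct A} (h : IsSuperring R)
    (hK : IsSuperfield R) {I : Set (PolyCarrier R)} (hI : IsIdeal (polyStruct R h) I)
    (m : ℕ) (g : PolyCarrier R) (hg : g ∈ I) (hgm : g.1 m ≠ R.zero)
    (hgt : ∀ k, m < k → g.1 k = R.zero)
    (hmin : ∀ f ∈ I, (∀ k, m ≤ k → f.1 k = R.zero) → ∀ k, f.1 k = R.zero)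
    (n : ℕ) : ∀ f ∈ I, (∀ k, m + n ≤ k → f.1 k = R.zero) →
      ∃ q : PolyCarrier R, (∀ j, n ≤ j → q.1 j = R.zero) ∧ f ∈ (polyStruct R h).mul q g := by
  induction n with
  | zero =>
    intro f hf hf0
    have := hmin f hf hf0
    refine ⟨(polyStruct R h).zero, fun _ _ => rfl, fun k => ?_⟩
    rw [aux_sum_zero h, this k]
    · rfl
    · intro j _
      exact aux_zero_mul h _
  | succ n ih =>
    intro f hf hf0
    obtain ⟨b, hb⟩ := hK.2 _ hgm
    obtain ⟨d, -, hd⟩ := h.mul_M3 _ _ _ _ _ hb (h.one_mul_mem (f.1 (m + n)))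
    rw [h.mul_comm] at hd
    choose y hy using fun k => h.mul_nonempty d (g.1 (k - n))
    let x : PolyCarrier R := ⟨fun k => if k < n then R.zero else if k = m + n then f.1 (m + n)
      else y k, m + n + 1, fun k hk => by
        have := hy k
        rw [hgt (k - n) (by omega), h.mul_zero] at this
        show (if _ then _ else _) = _
        rw [if_neg (by omega), if_neg (by omega)]
        exact this⟩
    have hxlt : ∀ k < n, x.1 k = R.zero := fun k hk => if_pos hk
    have hxN : x.1 (m + n) = f.1 (m + n) := by
      show (if _ then _ else _) = _
      rw [if_neg (by omega), if_pos rfl]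
    have hxge : ∀ k, n ≤ k → x.1 k ∈ R.mul d (g.1 (k - n)) := by
      intro k hk
      by_cases hkN : k = m + n
      · subst hkN
        rw [hxN, Nat.add_sub_cancel]; exact hd
      · have : x.1 k = y k := by
          show (if _ then _ else _) = _
          rw [if_neg (by omega), if_neg hkN]
        rw [this]; exact hy k
    have hxgt : ∀ k, m + n < k → x.1 k = R.zero := by
      intro k hk
      have := hxge k (by omega)
      rw [hgt (k - n) (by omega), h.mul_zero] at this
      exact this
    have hxI : x ∈ I := hI.2.2 (aux_mem_smul.mpr
      ⟨monoPoly R d n, trivial, g, hg, aux_mono_mul h d n g x hxlt hxge⟩)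
    have hzero : ∀ a, R.zero ∈ R.add a (R.neg a) := by
      intro a
      refine (h.add_M1 R.zero a a ?_).1
      rw [h.add_comm]; exact (h.add_M2 _ _).mpr rfl
    have hex : ∀ k, ∃ z, z ∈ R.add (f.1 k) (R.neg (x.1 k)) ∧ (m + n ≤ k → z = R.zero) := by
      intro k
      by_cases hk : m + n ≤ k
      · refine ⟨R.zero, ?_, fun _ => rfl⟩
        have : x.1 k = f.1 k := by
          rcases hk.eq_or_lt with e | hlt
          · rw [← e, hxN]
          · rw [hxgt k hlt, hf0 k (by omega)]
        rw [this]; exact hzero _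
      · obtain ⟨z, hz⟩ := h.add_nonempty (f.1 k) (R.neg (x.1 k))
        exact ⟨z, hz, fun h' => absurd h' hk⟩
    choose z hz hz0 using hex
    let f' : PolyCarrier R := ⟨z, m + n, hz0⟩
    have hf'I : f' ∈ I := hI.2.1 (aux_mem_sadd.mpr
      ⟨f, hf, (polyStruct R h).neg x, aux_neg_mem h hI hxI, hz⟩)
    obtain ⟨q, hq0, hq⟩ := ih f' hf'I hz0
    have hnn : ∀ a, R.neg (R.neg a) = a := by
      intro a
      have h1 := (h.add_M1 _ _ _ (hzero a)).1
      rw [h.add_comm] at h1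
      exact (h.add_M2 _ _).mp h1
    have hfk : ∀ k, f.1 k ∈ R.add (z k) (x.1 k) := by
      intro k
      have := (h.add_M1 _ _ _ (hz k)).1
      rwa [hnn] at this
    refine ⟨putCoeff R q d n, fun j hj => ?_, fun k => ?_⟩
    · show (if _ then _ else _) = _
      rw [if_neg (by omega), hq0 j (by omega)]
    · have hne : ∀ j, j ≠ n → (putCoeff R q d n).1 j = q.1 j := fun j hj => if_neg hj
      have heq : (putCoeff R q d n).1 n = d := if_pos rfl
      by_cases hk : k < n
      · have h1 := hfk k
        rw [hxlt k hk] at h1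
        rw [← (h.add_M2 _ _).mp h1, aux_sum_congr (G := fun j => R.mul (q.1 j) (g.1 (k - j)))]
        · exact hq k
        · intro j hj
          simp only [hne j (by omega)]
      · refine aux_sum_insert h (G := fun j => R.mul (q.1 j) (g.1 (k - j))) (i := n)
          (x := x.1 k) ?_ ?_ _ (by omega) ?_ (z k) _ (hq k) (hfk k)
        · rw [heq]; exact hxge k (by omega)
        · simp only [hq0 n le_rfl, aux_zero_mul h]
        · intro j _ hj
          simp only [hne j hj]

theorem aux_main {A : Type u} (R : SuperringStruct A) (h : IsSuperring R)
    (hK : IsSuperfield R)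
    (I : Set (PolyCarrier R)) (hI : IsIdeal (polyStruct R h) I) :
    ∃ p ∈ I, ∀ f ∈ I, ∃ q, f ∈ (polyStruct R h).mul q p := by
  classical
  by_cases hz : ∀ f ∈ I, ∀ k, f.1 k = R.zero
  · obtain ⟨p, hp⟩ := hI.1
    refine ⟨p, hp, fun f hf => ⟨p, fun k => ?_⟩⟩
    rw [hz f hf k, aux_sum_zero h]
    · rfl
    · intro j _
      rw [hz p hp j, aux_zero_mul h]
  · have key : ∀ f : PolyCarrier R, (¬ ∀ k, f.1 k = R.zero) →
        ∃ m, f.1 m ≠ R.zero ∧ ∀ k, m < k → f.1 k = R.zero := by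
      intro f hf
      have hex : ∃ N, ∀ n, N ≤ n → f.1 n = R.zero := f.2
      have hs := Nat.find_spec hex
      have hpos : Nat.find hex ≠ 0 := fun e => hf (fun k => hs k (by omega))
      refine ⟨Nat.find hex - 1, fun e => ?_, fun k hk => hs k (by omega)⟩
      refine Nat.find_min hex (m := Nat.find hex - 1) (by omega) (fun n hn => ?_)
      by_cases hn' : n = Nat.find hex - 1
      · rw [hn']; exact e
      · exact hs n (by omega)
    have hexm : ∃ m, ∃ g ∈ I, g.1 m ≠ R.zero ∧ ∀ k, m < k → g.1 k = R.zero := by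
      simp only [not_forall] at hz
      obtain ⟨f, hf, k, hk⟩ := hz
      obtain ⟨m, hm⟩ := key f (fun e => hk (e k))
      exact ⟨m, f, hf, hm⟩
    obtain ⟨g, hg, hgm, hgt⟩ := Nat.find_spec hexm
    refine ⟨g, hg, fun f hf => ?_⟩
    obtain ⟨N, hN⟩ := f.2
    obtain ⟨q, -, hq⟩ := aux_div h hK hI (Nat.find hexm) g hg hgm hgt (fun f hf hf0 => by
      by_contra hne
      obtain ⟨m, hm, hm'⟩ := key f hne
      have hlt : m < Nat.find hexm := by
        by_contra hge
        exact hm (hf0 m (by omega))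
      exact Nat.find_min hexm hlt ⟨f, hf, hm, hm'⟩) N f hf (fun k hk => hN k (by omega))
    exact ⟨q, hq⟩

/-- For a full superfield `F`, `F[X]` is a principal ideal superdomain: every ideal `I` is
`⟨p⟩` for some `p`, and moreover `I = F[X]·p = ⋃_{h} h·p`. -/
theorem stmt_10 {A : Type u} (R : SuperringStruct A) (h : IsSuperring R)
    (hfull : R.IsFull) (hK : IsSuperfield R)
    (I : Set (PolyCarrier R)) (hI : IsIdeal (polyStruct R h) I) :
    ∃ p : PolyCarrier R, I = genIdeal (polyStruct R h) p ∧
      I = ⋃ q : PolyCarrier R, (polyStruct R h).mul q p := by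
  obtain ⟨p, hp, hdiv⟩ := aux_main R h hK I hI
  have hsub : ∀ J : Set (PolyCarrier R), IsIdeal (polyStruct R h) J → p ∈ J → I ⊆ J := by
    intro J hJ hpJ f hf
    obtain ⟨q, hq⟩ := hdiv f hf
    exact hJ.2.2 (aux_mem_smul.mpr ⟨q, trivial, p, hpJ, hq⟩)
  refine ⟨p, ?_, ?_⟩
  · apply Set.Subset.antisymm
    · intro f hf J hJ
      exact hsub J hJ.1 hJ.2 hf
    · intro f hf
      exact hf I ⟨hI, hp⟩
  · ext f
    rw [Set.mem_iUnion]
    constructor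
    · exact hdiv f
    · rintro ⟨q, hq⟩
      exact hI.2.2 (aux_mem_smul.mpr ⟨q, trivial, p, hp, hq⟩)
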